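/- arXiv:2311.05999 — 3 statements merged into one kernel-verified Lean document; each statement's English description precedes it below -/
import Mathlib

section
/- Let N ≥ 3. There exists a constant C > 0, depending only on N, such that for every R > 2 and every function u : ℝ^N → ℝ which is continuously differentiable on an open neighborhood of the closed annulus {x ∈ ℝ^N : 1 ≤ |x| ≤ R}, one has ∫_{A_R} u(x)²/|x|² dx ≤ C ( ∫_{A_R} |∇u(x)|² dx + R^{−2} ∫_{A_R} u(x)² dx ), where A_R = {x ∈ ℝ^N : 1 < |x| < R}. -/
open MeasureTheory

/-- If the integral of `f` along every ray from the origin, with the radial weight of polar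
coordinates, is nonpositive, then so is the integral of `f`. -/
theorem integral_nonpos_of_integral_ray_nonpos {E : Type*} [NormedAddCommGroup E]
    [NormedSpace ℝ E] [MeasurableSpace E] [BorelSpace E] [FiniteDimensional ℝ E] [Nontrivial E]
    (μ : Measure E) [μ.IsAddHaarMeasure] (f : E → ℝ)
    (h : ∀ θ ∈ Metric.sphere (0 : E) 1,
      ∫ r in Set.Ioi (0 : ℝ), r ^ (Module.finrank ℝ E - 1) * f (r • θ) ≤ 0) :
    ∫ x, f x ∂μ ≤ 0 := by
  let F : Metric.sphere (0 : E) 1 × Set.Ioi (0 : ℝ) → ℝ := fun p ↦ f (p.2.1 • p.1.1)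
  have polar : ∫ x, f x ∂μ =
      ∫ p, F p ∂μ.toSphere.prod (.volumeIoiPow (Module.finrank ℝ E - 1)) := by
    rw [← μ.measurePreserving_homeomorphUnitSphereProd.integral_comp
      (Homeomorph.measurableEmbedding _) F]
    have hF (x : ({0}ᶜ : Set E)) : F (homeomorphUnitSphereProd E x) = f x := by
      have := congrArg Subtype.val ((homeomorphUnitSphereProd E).symm_apply_apply x)
      rw [homeomorphUnitSphereProd_symm_apply_coe] at this
      simp only [F, this]
    simp only [hF]
    rw [integral_subtype_comap (measurableSet_singleton _).compl f, restrict_compl_singleton]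
  rw [polar]
  by_cases hF : Integrable F (μ.toSphere.prod (.volumeIoiPow (Module.finrank ℝ E - 1)))
  · rw [integral_prod _ hF]
    refine integral_nonpos fun θ ↦ (le_of_eq ?_).trans (h θ.1 θ.2)
    simp only [Measure.volumeIoiPow, ENNReal.ofReal, F]
    rw [integral_withDensity_eq_integral_smul (measurable_subtype_coe.pow_const _).real_toNNReal,
      integral_subtype_comap measurableSet_Ioi fun a ↦
        Real.toNNReal (a ^ (Module.finrank ℝ E - 1)) • f (a • θ.1)]
    refine setIntegral_congr_fun measurableSet_Ioi fun x hx ↦ ?_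
    simp only [NNReal.smul_def, Real.coe_toNNReal _ (pow_nonneg (le_of_lt hx) _), smul_eq_mul]
  · rw [integral_undef hF]

/-- The one-dimensional weighted Hardy inequality on `(1, R)`, in which the contribution of the
endpoint `R` is replaced by a multiple of the weighted `L²` norm of `f`. -/
theorem integral_hardy_defect_nonpos (m : ℕ) {R : ℝ} (hR : 1 < R) {f f' G : ℝ → ℝ}
    (hf : ∀ r ∈ Set.Icc 1 R, HasDerivAt f (f' r) r) (hf' : ContinuousOn f' (Set.Icc 1 R))
    (hG : ContinuousOn G (Set.Icc 1 R)) (hle : ∀ r ∈ Set.Icc 1 R, |f' r| ≤ G r) :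
    ∫ r in Set.Ioo 1 R, r ^ (m + 2) *
      (1 / 2 * (f r ^ 2 / r ^ 2) - ((m + 3) / R ^ 2 * f r ^ 2 + 2 * G r ^ 2)) ≤ 0 := by
  have hfc : ContinuousOn f (Set.Icc 1 R) := HasDerivAt.continuousOn hf
  have hne : ∀ r ∈ Set.Icc 1 R, r ^ 2 ≠ 0 := fun r hr ↦ by
    have : 0 < r := by linarith [hr.1]
    positivity
  set D : ℝ → ℝ := fun r ↦ 2 * f r * f' r * (r ^ (m + 1) - r ^ (m + 3) / R ^ 2) +
    f r ^ 2 * ((m + 1) * r ^ m - (m + 3) * r ^ (m + 2) / R ^ 2) with hD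
  have hDc : ContinuousOn D (Set.Icc 1 R) := by fun_prop
  have hderiv : ∀ r ∈ Set.uIcc 1 R,
      HasDerivAt (fun r ↦ f r ^ 2 * (r ^ (m + 1) - r ^ (m + 3) / R ^ 2)) (D r) r := by
    intro r hr
    rw [Set.uIcc_of_le hR.le] at hr
    refine HasDerivAt.congr_deriv (((hf r hr).pow 2).mul
      ((hasDerivAt_pow (m + 1) r).sub ((hasDerivAt_pow (m + 3) r).div_const (R ^ 2)))) ?_
    simp only [hD, Pi.pow_apply]
    push_cast
    simp
  have ftc := intervalIntegral.integral_eq_sub_of_hasDerivAt hderiv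
    (ContinuousOn.intervalIntegrable_of_Icc hR.le hDc)
  rw [intervalIntegral.integral_of_le hR.le, integral_Ioc_eq_integral_Ioo] at ftc
  have hR0 : R ≠ 0 := by positivity
  calc _ ≤ ∫ r in Set.Ioo 1 R, D r := by
        refine setIntegral_mono_on ?_ ?_ measurableSet_Ioo fun r hr ↦ ?_
        · refine (ContinuousOn.integrableOn_Icc ?_).mono_set Set.Ioo_subset_Icc_self
          exact (continuousOn_id.pow _).mul ((continuousOn_const.mul
            ((hfc.pow 2).div (continuousOn_id.pow 2) hne)).sub
            ((continuousOn_const.mul (hfc.pow 2)).add (continuousOn_const.mul (hG.pow 2))))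
        · exact hDc.integrableOn_Icc.mono_set Set.Ioo_subset_Icc_self
        · have hr' := Set.Ioo_subset_Icc_self hr
          have hr0 : 0 < r := by linarith [hr.1]
          have hsq : f' r ^ 2 ≤ G r ^ 2 := sq_le_sq' (neg_le_of_abs_le (hle r hr'))
            (le_of_abs_le (hle r hr'))
          obtain ⟨s, hs⟩ : ∃ s, s = 1 - r ^ 2 / R ^ 2 := ⟨_, rfl⟩
          have hs1 : s ≤ 1 := by rw [hs]; linarith [show 0 ≤ r ^ 2 / R ^ 2 by positivity]
          have hs0 : 0 ≤ s := by
            rw [hs, sub_nonneg, div_le_one (by positivity)]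
            exact pow_le_pow_left₀ hr0.le hr.2.le 2
          have key : 0 ≤ r ^ m * (m * f r ^ 2 + 1 / 2 * (f r + 2 * s * r * f' r) ^ 2 +
              2 * r ^ 2 * ((1 - s ^ 2) * f' r ^ 2 + (G r ^ 2 - f' r ^ 2))) := by
            have h1 : 0 ≤ 1 - s ^ 2 := by nlinarith
            have h2 := sub_nonneg.2 hsq
            positivity
          refine le_of_sub_nonneg (key.trans_eq ?_)
          rw [hs, hD]
          field_simp
          ring
    _ ≤ 0 := by
        rw [ftc, show R ^ (m + 3) / R ^ 2 = R ^ (m + 1) by field_simp; ring]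
        have : 1 / R ^ 2 ≤ 1 := by
          rw [div_le_one (by positivity)]
          nlinarith
        have := mul_nonneg (sq_nonneg (f 1)) (sub_nonneg.2 this)
        simpa using this

/-- Hardy-type inequality on annuli `{1 < |x| < R}` in `ℝ^N`, `N ≥ 3`, with a constant
independent of the outer radius `R`. -/
theorem hardy_inequality_on_annuli (N : ℕ) (hN : 3 ≤ N) :
    ∃ C : ℝ, 0 < C ∧
      ∀ R : ℝ, 2 < R →
        ∀ u : EuclideanSpace ℝ (Fin N) → ℝ,
          (∃ V : Set (EuclideanSpace ℝ (Fin N)), IsOpen V ∧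
              {x : EuclideanSpace ℝ (Fin N) | 1 ≤ ‖x‖ ∧ ‖x‖ ≤ R} ⊆ V ∧
              ContDiffOn ℝ 1 u V) →
          ∫ x in {x : EuclideanSpace ℝ (Fin N) | 1 < ‖x‖ ∧ ‖x‖ < R}, u x ^ 2 / ‖x‖ ^ 2 ≤
            C * ((∫ x in {x : EuclideanSpace ℝ (Fin N) | 1 < ‖x‖ ∧ ‖x‖ < R},
                    ‖gradient u x‖ ^ 2) +
                 R ^ (-2 : ℤ) *
                   ∫ x in {x : EuclideanSpace ℝ (Fin N) | 1 < ‖x‖ ∧ ‖x‖ < R}, u x ^ 2) := by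
  obtain ⟨m, rfl⟩ := Nat.exists_eq_add_of_le' hN
  refine ⟨2 * (m + 3), by positivity, ?_⟩
  rintro R hR u ⟨V, hVo, hV, hu⟩
  set A : Set (EuclideanSpace ℝ (Fin (m + 3))) := {x | 1 < ‖x‖ ∧ ‖x‖ < R} with hA
  set K : Set (EuclideanSpace ℝ (Fin (m + 3))) := {x | 1 ≤ ‖x‖ ∧ ‖x‖ ≤ R} with hK
  have hAK : A ⊆ K := fun x hx ↦ ⟨hx.1.le, hx.2.le⟩
  have hAm : MeasurableSet A :=
    ((isOpen_lt continuous_const continuous_norm).inter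
      (isOpen_lt continuous_norm continuous_const)).measurableSet
  have hKc : IsCompact K := by
    refine (isCompact_closedBall (0 : EuclideanSpace ℝ (Fin (m + 3))) R).of_isClosed_subset
      ((isClosed_le continuous_const continuous_norm).inter
        (isClosed_le continuous_norm continuous_const)) fun x hx ↦ ?_
    simpa using hx.2
  have hgrad (x : EuclideanSpace ℝ (Fin (m + 3))) : ‖gradient u x‖ = ‖fderiv ℝ u x‖ := by
    rw [← toDual_gradient, LinearIsometryEquiv.norm_map]
  have hfd : ContinuousOn (fderiv ℝ u) V := hu.continuousOn_fderiv_of_isOpen hVo le_rfl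
  have int {g : EuclideanSpace ℝ (Fin (m + 3)) → ℝ} (hg : ContinuousOn g K) :
      IntegrableOn g A := (hg.integrableOn_compact hKc).mono_set hAK
  have int1 : IntegrableOn (fun x ↦ u x ^ 2 / ‖x‖ ^ 2) A :=
    int (((hu.continuousOn.mono hV).pow 2).div (continuous_norm.continuousOn.pow 2) fun x hx ↦ by
      have : 0 < ‖x‖ := by linarith [hx.1]
      positivity)
  have int2 : IntegrableOn (fun x ↦ u x ^ 2) A := int ((hu.continuousOn.mono hV).pow 2)
  have int3 : IntegrableOn (fun x ↦ ‖gradient u x‖ ^ 2) A := by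
    simp only [hgrad]
    exact int ((hfd.mono hV).norm.pow 2)
  have main : ∫ x in A, (1 / 2 * (u x ^ 2 / ‖x‖ ^ 2) -
      ((m + 3) / R ^ 2 * u x ^ 2 + 2 * ‖gradient u x‖ ^ 2)) ≤ 0 := by
    rw [← integral_indicator hAm]
    refine integral_nonpos_of_integral_ray_nonpos _ _ fun θ hθ ↦ ?_
    have hθ1 : ‖θ‖ = 1 := by simpa using hθ
    have hnorm {r : ℝ} (hr : 0 < r) : ‖r • θ‖ = r := by
      rw [norm_smul, hθ1, mul_one, Real.norm_of_nonneg hr.le]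
    have hmaps : Set.MapsTo (fun r : ℝ ↦ r • θ) (Set.Icc 1 R) V := fun r hr ↦ hV <| by
      simpa only [hK, Set.mem_ofPred_eq, Set.mem_Icc, hnorm (zero_lt_one.trans_le hr.1)] using hr
    have hray : ContinuousOn (fun r : ℝ ↦ fderiv ℝ u (r • θ)) (Set.Icc 1 R) :=
      hfd.comp (by fun_prop) hmaps
    refine (le_of_eq ?_).trans (integral_hardy_defect_nonpos m (by linarith : 1 < R)
      (f := fun r ↦ u (r • θ)) (f' := fun r ↦ fderiv ℝ u (r • θ) θ)
      (G := fun r ↦ ‖gradient u (r • θ)‖) (fun r hr ↦ ?_) (hray.clm_apply continuousOn_const)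
      ?_ fun r _ ↦ ?_)
    · rw [← Set.inter_eq_self_of_subset_right
          (Set.Ioo_subset_Ioi_self.trans (Set.Ioi_subset_Ioi zero_le_one) :
            Set.Ioo 1 R ⊆ Set.Ioi 0), ← setIntegral_indicator measurableSet_Ioo]
      refine setIntegral_congr_fun measurableSet_Ioi fun r hr ↦ ?_
      have hmem : r • θ ∈ A ↔ r ∈ Set.Ioo 1 R := by
        simp only [hA, Set.mem_ofPred_eq, hnorm hr, Set.mem_Ioo]
      by_cases h : r ∈ Set.Ioo 1 R
      · simp [Set.indicator_of_mem h, Set.indicator_of_mem (hmem.2 h), hnorm hr]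
      · simp [Set.indicator_of_notMem h, Set.indicator_of_notMem (mt hmem.1 h)]
    · have hd := ((hu.contDiffAt (hVo.mem_nhds (hmaps hr))).differentiableAt
        one_ne_zero).hasFDerivAt
      have hl : HasDerivAt (fun r : ℝ ↦ r • θ) θ r := by
        simpa using (hasDerivAt_id r).smul_const θ
      exact hd.comp_hasDerivAt r hl
    · simp only [hgrad]
      exact hray.norm
    · rw [hgrad, ← Real.norm_eq_abs]
      simpa [hθ1] using (fderiv ℝ u (r • θ)).le_opNorm θ
  rw [integral_sub (g := fun x ↦ (m + 3) / R ^ 2 * u x ^ 2 + 2 * ‖gradient u x‖ ^ 2)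
      (int1.const_mul _) ((int2.const_mul _).add (int3.const_mul _)),
    integral_add (int2.const_mul _) (int3.const_mul _), integral_const_mul, integral_const_mul,
    integral_const_mul] at main
  have hnonneg : 0 ≤ ∫ x in A, ‖gradient u x‖ ^ 2 := integral_nonneg fun x ↦ by positivity
  have hzpow : R ^ (-2 : ℤ) = 1 / R ^ 2 := by
    rw [zpow_neg, one_div]
    norm_cast
  have hcoef : ((m : ℝ) + 3) / R ^ 2 = (m + 3) * (1 / R ^ 2) := by ring
  rw [hcoef] at main
  rw [hzpow]
  have hm : (0 : ℝ) ≤ m := m.cast_nonneg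
  nlinarith [mul_nonneg hm hnonneg]
end

section
/- Let N ≥ 3. There exists a constant C > 0, depending only on N, such that for every smooth compactly supported function u : ℝ^N → ℝ, ∫_{{|x|>1}} u(x)²/|x|² dx ≤ C ∫_{{|x|>1}} |∇u(x)|² dx, where the integrals are taken over the exterior {x ∈ ℝ^N : |x| > 1} of the closed unit ball. -/
open MeasureTheory

/-- Integration in polar coordinates with respect to an additive Haar measure. -/
theorem integral_eq_integral_toSphere_integral_Ioi {E : Type*} [NormedAddCommGroup E]
    [NormedSpace ℝ E] [MeasurableSpace E] [BorelSpace E] [FiniteDimensional ℝ E] [Nontrivial E]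
    (μ : Measure E) [μ.IsAddHaarMeasure] {F : E → ℝ} (hF : Integrable F μ) :
    ∫ x, F x ∂μ = ∫ θ : Metric.sphere (0 : E) 1, (∫ r in Set.Ioi (0 : ℝ),
      r ^ (Module.finrank ℝ E - 1) * F (r • (θ : E))) ∂μ.toSphere := by
  have hmp := μ.measurePreserving_homeomorphUnitSphereProd
  have hemb := (homeomorphUnitSphereProd E).measurableEmbedding
  set G : Metric.sphere (0 : E) 1 × Set.Ioi (0 : ℝ) → ℝ := fun p => F ((p.2 : ℝ) • (p.1 : E))
  have hG : G ∘ homeomorphUnitSphereProd E = fun x : ({0}ᶜ : Set E) => F x := by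
    ext x
    have hx : ‖(x : E)‖ ≠ 0 := norm_ne_zero_iff.2 x.2
    simp [G, smul_smul, hx]
  have hGint : Integrable G (μ.toSphere.prod (.volumeIoiPow (Module.finrank ℝ E - 1))) := by
    rw [← hmp.integrable_comp_emb hemb, hG]
    exact (integrableOn_iff_comap_subtypeVal (measurableSet_singleton _).compl).1 hF.integrableOn
  calc
    ∫ x, F x ∂μ = ∫ x : ({(0)}ᶜ : Set E), F x ∂(μ.comap (↑)) := by
      rw [integral_subtype_comap (measurableSet_singleton _).compl F,
        restrict_compl_singleton]
    _ = ∫ p, G p ∂μ.toSphere.prod (.volumeIoiPow (Module.finrank ℝ E - 1)) := by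
      rw [← hmp.integral_comp hemb]
      exact congrArg (fun f => ∫ x, f x ∂(μ.comap Subtype.val)) hG.symm
    _ = _ := by
      rw [integral_prod _ hGint]
      refine integral_congr_ae (.of_forall fun θ => ?_)
      simp only [Measure.volumeIoiPow, ENNReal.ofReal, G]
      rw [integral_withDensity_eq_integral_smul,
        integral_subtype_comap measurableSet_Ioi fun a : ℝ ↦
          Real.toNNReal (a ^ (Module.finrank ℝ E - 1)) • F (a • (θ : E)),
        setIntegral_congr_fun measurableSet_Ioi fun x hx ↦ ?_]
      · rw [NNReal.smul_def, Real.coe_toNNReal _ (pow_nonneg hx.out.le _), smul_eq_mul]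
      · exact (measurable_subtype_coe.pow_const _).real_toNNReal

/-- One-dimensional weighted Hardy inequality on `(1, ∞)`, in the form that the integral of any
majorant of the difference of the two sides is nonnegative. -/
theorem integral_Ioi_one_nonneg_of_hardy_le {f : ℝ → ℝ} (hf : ContDiff ℝ 1 f)
    (hsupp : HasCompactSupport f) (k : ℕ) {Φ : ℝ → ℝ}
    (hΦ : ∀ r, 1 < r → r ^ (k + 2) * (4 * deriv f r ^ 2 - f r ^ 2 / r ^ 2) ≤ Φ r) :
    0 ≤ ∫ r in Set.Ioi (1 : ℝ), Φ r := by
  by_cases hΦint : IntegrableOn Φ (Set.Ioi 1)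
  swap
  · rw [integral_undef hΦint]
  set h : ℝ → ℝ := fun r => r ^ (k + 1) * f r ^ 2
  have hh : ContDiff ℝ 1 h := by fun_prop
  have hhs : HasCompactSupport h := by
    have : h = fun r => (r ^ (k + 1) * f r) * f r := by ext; simp only [h]; ring
    rw [this]
    exact hsupp.mul_left
  have hderiv (r : ℝ) :
      deriv h r = (k + 1) * r ^ k * f r ^ 2 + r ^ (k + 1) * (2 * f r * deriv f r) := by
    have hfr := (hf.differentiable one_ne_zero r).hasDerivAt
    have := (hasDerivAt_pow (k + 1) r).mul (hfr.pow 2)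
    simpa [h, Pi.mul_def] using this.deriv
  have hdint : IntegrableOn (fun r => -2 * deriv h r) (Set.Ioi 1) :=
    (((hh.continuous_deriv le_rfl).integrable_of_hasCompactSupport hhs.deriv).const_mul
      _).integrableOn
  calc
    0 ≤ -2 * (-h 1) := by simp only [h, one_pow]; nlinarith [sq_nonneg (f 1)]
    _ = ∫ r in Set.Ioi (1 : ℝ), -2 * deriv h r := by
      rw [integral_const_mul, hhs.integral_Ioi_deriv_eq hh]
    _ ≤ ∫ r in Set.Ioi (1 : ℝ), Φ r := by
      refine setIntegral_mono_on hdint hΦint measurableSet_Ioi fun r hr => ?_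
      have hr0 : 0 < r := one_pos.trans hr
      refine le_trans ?_ (hΦ r hr)
      have key : r ^ (k + 2) * (4 * deriv f r ^ 2 - f r ^ 2 / r ^ 2) - -2 * deriv h r =
          r ^ k * ((2 * r * deriv f r + f r) ^ 2 + 2 * k * f r ^ 2) := by
        rw [hderiv]
        field_simp
        ring
      have : 0 ≤ r ^ k * ((2 * r * deriv f r + f r) ^ 2 + 2 * k * f r ^ 2) := by positivity
      linarith

/-- Hardy-type inequality on the exterior of the unit ball in `ℝ^N`, `N ≥ 3`, for smooth
compactly supported functions (not required to vanish near the unit sphere). -/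
theorem hardy_inequality_exterior_domain (N : ℕ) (hN : 3 ≤ N) :
    ∃ C : ℝ, 0 < C ∧
      ∀ u : EuclideanSpace ℝ (Fin N) → ℝ,
        ContDiff ℝ (⊤ : ℕ∞) u → HasCompactSupport u →
          ∫ x in {x : EuclideanSpace ℝ (Fin N) | 1 < ‖x‖}, u x ^ 2 / ‖x‖ ^ 2 ≤
            C * ∫ x in {x : EuclideanSpace ℝ (Fin N) | 1 < ‖x‖}, ‖gradient u x‖ ^ 2 := by
  refine ⟨4, by norm_num, fun u hu hsupp => ?_⟩
  obtain ⟨k, rfl⟩ := Nat.exists_eq_add_of_le' hN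
  set S := {x : EuclideanSpace ℝ (Fin (k + 3)) | 1 < ‖x‖}
  have hS : MeasurableSet S := measurableSet_lt measurable_const measurable_norm
  have hnorm (x) : ‖gradient u x‖ = ‖fderiv ℝ u x‖ := by simp [gradient]
  simp only [hnorm]
  have hI_grad : IntegrableOn (fun x => ‖fderiv ℝ u x‖ ^ 2) S := by
    refine (Continuous.integrable_of_hasCompactSupport ?_ ?_).integrableOn
    · exact (hu.continuous_fderiv (by simp)).norm.pow 2
    · exact (hsupp.fderiv ℝ).comp_left (g := fun L => ‖L‖ ^ 2) (by simp)
  have hI_u : IntegrableOn (fun x => u x ^ 2 / ‖x‖ ^ 2) S := by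
    have hsq : IntegrableOn (fun x => u x ^ 2) S := by
      refine (Continuous.integrable_of_hasCompactSupport ?_ ?_).integrableOn
      · exact hu.continuous.pow 2
      · exact hsupp.comp_left (g := fun t : ℝ => t ^ 2) (by simp)
    refine hsq.mono' ?_ ?_
    · exact ((hu.continuous.measurable.pow_const 2).div
        (measurable_norm.pow_const 2)).aestronglyMeasurable
    · filter_upwards [ae_restrict_mem hS] with x hx
      rw [Real.norm_of_nonneg (by positivity)]
      exact div_le_self (sq_nonneg _) (one_le_pow₀ (le_of_lt hx))
  have hI_diff : IntegrableOn (fun x => 4 * ‖fderiv ℝ u x‖ ^ 2 - u x ^ 2 / ‖x‖ ^ 2) S :=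
    (hI_grad.const_mul 4).sub hI_u
  rw [← integral_const_mul, ← sub_nonneg, ← integral_sub (hI_grad.const_mul 4) hI_u,
    ← integral_indicator hS, integral_eq_integral_toSphere_integral_Ioi _
      ((integrable_indicator_iff hS).2 hI_diff)]
  refine integral_nonneg fun θ => ?_
  have hθ : ‖(θ : EuclideanSpace ℝ (Fin (k + 3)))‖ = 1 := by simp
  have hiso : Isometry fun r : ℝ => r • (θ : EuclideanSpace ℝ (Fin (k + 3))) :=
    Isometry.of_dist_eq fun a b => by
      rw [dist_eq_norm, ← sub_smul, norm_smul, hθ, mul_one, dist_eq_norm]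
  have hmem {r : ℝ} (hr : 0 < r) : r • (θ : EuclideanSpace ℝ (Fin (k + 3))) ∈ S ↔ 1 < r := by
    simp [S, norm_smul, abs_of_pos hr]
  rw [setIntegral_eq_of_subset_of_forall_sdiff_eq_zero measurableSet_Ioi
    (Set.Ioi_subset_Ioi zero_le_one)]
  · refine integral_Ioi_one_nonneg_of_hardy_le (f := fun r => u (r • θ)) (k := k) ?_
      (hsupp.comp_isClosedEmbedding hiso.isClosedEmbedding) fun r hr => ?_
    · exact (hu.of_le (by simp)).comp (contDiff_id.smul contDiff_const)
    · have hr0 : 0 < r := one_pos.trans hr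
      have hd : deriv (fun r : ℝ => u (r • (θ : EuclideanSpace ℝ (Fin (k + 3))))) r =
          fderiv ℝ u (r • θ) θ := by
        have h1 := (hasDerivAt_id r).smul_const (θ : EuclideanSpace ℝ (Fin (k + 3)))
        have h2 := (hu.differentiable (by simp) (r • θ)).hasFDerivAt
        simpa [Function.comp_def] using (h2.comp_hasDerivAt r h1).deriv
      have hle : (fderiv ℝ u (r • θ) θ) ^ 2 ≤ ‖fderiv ℝ u (r • θ)‖ ^ 2 := by
        rw [← sq_abs, ← Real.norm_eq_abs]
        gcongr
        simpa [hθ] using (fderiv ℝ u (r • θ)).le_opNorm θ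
      rw [Set.indicator_of_mem ((hmem hr0).2 hr), finrank_euclideanSpace_fin, hd, norm_smul, hθ,
        mul_one, Real.norm_of_nonneg hr0.le]
      simp only [Nat.add_succ_sub_one]
      gcongr
  · rintro r ⟨hr0, hr1⟩
    rw [Set.indicator_of_notMem (mt (hmem hr0).1 hr1), mul_zero]
end

section
/- Let 0 < ε < R, let j ≥ 1 be an integer, and let a ∈ ℝ. Define φ : (0, ∞) → ℝ by φ(r) = (j a ε^j / (1 − (ε/R)²)) · ( log r − r²/(2R²) + 1/2 + (ε² log ε − R² log R)/(R² − ε²) + (R² + ε²)/(4R²) ). Then φ satisfies: (i) −φ''(r) − φ'(r)/r = 2 j a ε^j/(R² − ε²) for all r ∈ (ε, R); (ii) φ'(ε) = j ε^{j−1} a; (iii) φ'(R) = 0; (iv) ∫_ε^R r φ(r) dr = 0. Moreover, φ is the unique twice continuously differentiable function on [ε, R] satisfying (i)–(iv). -/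
open MeasureTheory

/-- The explicit zero-average radial (mode-zero) component of the torsion function on the
annulus `B_R ∖ B_ε ⊆ ℝ²`. -/
noncomputable def radialTorsionModeZero (ε R : ℝ) (j : ℕ) (a : ℝ) : ℝ → ℝ :=
  fun r => ((j : ℝ) * a * ε ^ j / (1 - (ε / R) ^ 2)) *
    (Real.log r - r ^ 2 / (2 * R ^ 2) + 1 / 2 +
      (ε ^ 2 * Real.log ε - R ^ 2 * Real.log R) / (R ^ 2 - ε ^ 2) +
      (R ^ 2 + ε ^ 2) / (4 * R ^ 2))

/-- The derivative of the radial torsion component. -/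
theorem hasDerivAt_radialTorsionModeZero {ε R : ℝ} (hε : 0 < ε) (hεR : ε < R) (j : ℕ) (a : ℝ)
    {r : ℝ} (hr : r ≠ 0) :
    HasDerivAt (radialTorsionModeZero ε R j a)
      (((j : ℝ) * a * ε ^ j / (R ^ 2 - ε ^ 2)) * (R ^ 2 / r - r)) r := by
  have hR : R ≠ 0 := (hε.trans hεR).ne'
  have hd : R ^ 2 - ε ^ 2 ≠ 0 := by nlinarith
  have h := (((((Real.hasDerivAt_log hr).sub (((hasDerivAt_id r).pow 2).div_const (2 * R ^ 2))).add_const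
    (1 / 2 : ℝ)).add_const ((ε ^ 2 * Real.log ε - R ^ 2 * Real.log R) / (R ^ 2 - ε ^ 2))).add_const
      ((R ^ 2 + ε ^ 2) / (4 * R ^ 2))).const_mul ((j : ℝ) * a * ε ^ j / (1 - (ε / R) ^ 2))
  refine h.congr_deriv ?_
  have he : 1 - (ε / R) ^ 2 = (R ^ 2 - ε ^ 2) / R ^ 2 := by field_simp
  rw [he]
  simp only [id]
  field_simp
  norm_num
  ring

/-- A continuous function on `[a, b]` whose derivative vanishes on `(a, b)` is constant. -/
theorem eq_left_of_hasDerivAt_zero {f : ℝ → ℝ} {a b : ℝ} (hc : ContinuousOn f (Set.Icc a b))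
    (hd : ∀ x ∈ Set.Ioo a b, HasDerivAt f 0 x) {x : ℝ} (hx : x ∈ Set.Icc a b) : f x = f a := by
  rcases hx.1.eq_or_lt with rfl | hlt
  · rfl
  obtain ⟨c, -, h⟩ := exists_hasDerivAt_eq_slope f (fun _ => 0) hlt
    (hc.mono (Set.Icc_subset_Icc_right hx.2)) fun y hy => hd y ⟨hy.1, hy.2.trans_le hx.2⟩
  have : x - a ≠ 0 := (sub_pos.2 hlt).ne'
  field_simp at h
  linarith

/-- The radial torsion component has zero weighted average. -/
theorem integral_mul_radialTorsionModeZero {ε R : ℝ} (hε : 0 < ε) (hεR : ε < R) (j : ℕ) (a : ℝ) :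
    ∫ r in ε..R, r * radialTorsionModeZero ε R j a r = 0 := by
  have hR : R ≠ 0 := (hε.trans hεR).ne'
  have hd : R ^ 2 - ε ^ 2 ≠ 0 := by nlinarith
  set C : ℝ := 1 / 2 + (ε ^ 2 * Real.log ε - R ^ 2 * Real.log R) / (R ^ 2 - ε ^ 2) +
    (R ^ 2 + ε ^ 2) / (4 * R ^ 2) with hC
  set K : ℝ := (j : ℝ) * a * ε ^ j / (1 - (ε / R) ^ 2) with hK
  have hpos : ∀ r ∈ Set.uIcc ε R, r ≠ 0 := fun r hr =>
    (hε.trans_le (by rw [Set.uIcc_of_le hεR.le] at hr; exact hr.1)).ne'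
  have hF : ∀ r ∈ Set.uIcc ε R, HasDerivAt
      (fun r => K * (r ^ 2 / 2 * Real.log r - r ^ 2 / 4 - r ^ 4 / (8 * R ^ 2) + C * r ^ 2 / 2))
      (r * radialTorsionModeZero ε R j a r) r := by
    intro r hr
    have h0 := hpos r hr
    have h2 := hasDerivAt_pow 2 r
    have h4 := hasDerivAt_pow 4 r
    have h := (((((h2.div_const 2).mul (Real.hasDerivAt_log h0)).sub (h2.div_const 4)).sub
      (h4.div_const (8 * R ^ 2))).add ((h2.const_mul C).div_const 2)).const_mul K
    refine h.congr_deriv ?_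
    have : radialTorsionModeZero ε R j a r = K * (Real.log r - r ^ 2 / (2 * R ^ 2) + C) := by
      simp only [radialTorsionModeZero, hC, hK]
      ring
    rw [this]
    clear_value C K
    field_simp
    norm_num
    ring
  rw [intervalIntegral.integral_eq_sub_of_hasDerivAt hF]
  · clear_value K
    rw [hC]
    field_simp
    ring
  · refine ContinuousOn.intervalIntegrable fun r hr => ?_
    exact (continuousAt_id.mul (hasDerivAt_radialTorsionModeZero hε hεR j a
      (hpos r hr)).continuousAt).continuousWithinAt

/-- The function `radialTorsionModeZero ε R j a` solves the mode-zero radial problem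
(equazione-phi0): the inhomogeneous radial ODE on `(ε, R)` with Neumann data
`φ'(ε) = j ε^{j−1} a`, `φ'(R) = 0` and zero weighted average; moreover it is the unique
`C²` function on `[ε, R]` with these properties. -/
theorem radial_torsion_mode_zero_characterization
    (ε R : ℝ) (hε : 0 < ε) (hεR : ε < R) (j : ℕ) (hj : 1 ≤ j) (a : ℝ) :
    (∀ r ∈ Set.Ioo ε R,
        -(deriv (deriv (radialTorsionModeZero ε R j a)) r)
          - deriv (radialTorsionModeZero ε R j a) r / r
          = 2 * (j : ℝ) * a * ε ^ j / (R ^ 2 - ε ^ 2)) ∧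
    deriv (radialTorsionModeZero ε R j a) ε = (j : ℝ) * ε ^ (j - 1) * a ∧
    deriv (radialTorsionModeZero ε R j a) R = 0 ∧
    (∫ r in ε..R, r * radialTorsionModeZero ε R j a r) = 0 ∧
    (∀ ψ : ℝ → ℝ, ContDiffOn ℝ 2 ψ (Set.Icc ε R) →
      (∀ r ∈ Set.Ioo ε R,
          -(derivWithin (derivWithin ψ (Set.Icc ε R)) (Set.Icc ε R) r)
            - derivWithin ψ (Set.Icc ε R) r / r
            = 2 * (j : ℝ) * a * ε ^ j / (R ^ 2 - ε ^ 2)) →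
      derivWithin ψ (Set.Icc ε R) ε = (j : ℝ) * ε ^ (j - 1) * a →
      derivWithin ψ (Set.Icc ε R) R = 0 →
      (∫ r in ε..R, r * ψ r) = 0 →
      ∀ r ∈ Set.Icc ε R, ψ r = radialTorsionModeZero ε R j a r) := by
  have hR0 : 0 < R := hε.trans hεR
  have hd : R ^ 2 - ε ^ 2 ≠ 0 := by nlinarith
  set K : ℝ := (j : ℝ) * a * ε ^ j / (R ^ 2 - ε ^ 2) with hK
  have hφ : ∀ r : ℝ, r ≠ 0 → HasDerivAt (radialTorsionModeZero ε R j a) (K * (R ^ 2 / r - r)) r :=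
    fun r hr => hasDerivAt_radialTorsionModeZero hε hεR j a hr
  have hS : 2 * (j : ℝ) * a * ε ^ j / (R ^ 2 - ε ^ 2) = 2 * K := by rw [hK]; ring
  have hKε : K * (R ^ 2 / ε - ε) = (j : ℝ) * ε ^ (j - 1) * a := by
    obtain ⟨k, rfl⟩ := Nat.exists_eq_add_of_le' hj
    rw [hK, Nat.add_sub_cancel, pow_succ]
    field_simp
  rw [hS]
  have hint := integral_mul_radialTorsionModeZero hε hεR j a
  refine ⟨fun r hr => ?_, ?_, ?_, hint, ?_⟩
  · have hr0 : r ≠ 0 := (hε.trans hr.1).ne'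
    have hev : deriv (radialTorsionModeZero ε R j a) =ᶠ[nhds r] fun x => K * (R ^ 2 * x⁻¹ - x) := by
      filter_upwards [isOpen_ne.mem_nhds hr0] with x hx
      rw [(hφ x hx).deriv, div_eq_mul_inv]
    have h := (((hasDerivAt_inv hr0).const_mul (R ^ 2)).sub (hasDerivAt_id r)).const_mul K
    have h' : deriv (deriv (radialTorsionModeZero ε R j a)) r = _ :=
      hev.deriv_eq.trans h.deriv
    rw [h', (hφ r hr0).deriv]
    clear_value K
    field_simp
    ring
  · rw [(hφ ε hε.ne').deriv, hKε]
  · rw [(hφ R hR0.ne').deriv]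
    field_simp
    ring
  · intro ψ hψ hode hl _ hψint
    have hu : UniqueDiffOn ℝ (Set.Icc ε R) := uniqueDiffOn_Icc hεR
    have hp : ContDiffOn ℝ 1 (derivWithin ψ (Set.Icc ε R)) (Set.Icc ε R) :=
      hψ.derivWithin hu (by norm_num)
    set p := derivWithin ψ (Set.Icc ε R) with hpdef
    have hprod : ∀ r ∈ Set.Icc ε R, r * p r - K * (R ^ 2 - r ^ 2) = 0 := by
      intro r hr
      rw [eq_left_of_hasDerivAt_zero (f := fun r => r * p r - K * (R ^ 2 - r ^ 2)) ?_ ?_ hr]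
      · simp only [hl, ← hKε]
        field_simp
        ring
      · have := hp.continuousOn
        fun_prop
      · intro x hx
        have hx0 : x ≠ 0 := (hε.trans hx.1).ne'
        have hpx : HasDerivAt p (derivWithin p (Set.Icc ε R) x) x :=
          ((hp.differentiableOn one_ne_zero x
            (Set.Ioo_subset_Icc_self hx)).hasDerivWithinAt).hasDerivAt (Icc_mem_nhds hx.1 hx.2)
        refine (((hasDerivAt_id x).mul hpx).sub
          (((hasDerivAt_pow 2 x).const_sub (R ^ 2)).const_mul K)).congr_deriv ?_
        have h := hode x hx
        clear_value K p
        field_simp at h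
        simp only [id]
        norm_num
        linarith
    have hconst : ∀ r ∈ Set.Icc ε R, ψ r - radialTorsionModeZero ε R j a r =
        ψ ε - radialTorsionModeZero ε R j a ε := by
      intro r hr
      refine eq_left_of_hasDerivAt_zero
        (f := fun r => ψ r - radialTorsionModeZero ε R j a r) ?_ ?_ hr
      · exact hψ.continuousOn.sub fun x hx =>
          (hφ x (hε.trans_le hx.1).ne').continuousAt.continuousWithinAt
      · intro x hx
        have hx0 : x ≠ 0 := (hε.trans hx.1).ne'
        have hψx : HasDerivAt ψ (p x) x :=
          ((hψ.differentiableOn two_ne_zero x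
            (Set.Ioo_subset_Icc_self hx)).hasDerivWithinAt).hasDerivAt (Icc_mem_nhds hx.1 hx.2)
        refine (hψx.sub (hφ x hx0)).congr_deriv ?_
        have h := hprod x (Set.Ioo_subset_Icc_self hx)
        clear_value K p
        field_simp
        linarith
    set c := ψ ε - radialTorsionModeZero ε R j a ε with hc
    have hψeq : ∫ r in ε..R, r * ψ r =
        ∫ r in ε..R, (r * radialTorsionModeZero ε R j a r + r * c) := by
      refine intervalIntegral.integral_congr fun r hr => ?_
      rw [Set.uIcc_of_le hεR.le] at hr
      simp only [← hconst r hr]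
      ring
    rw [intervalIntegral.integral_add, hint, intervalIntegral.integral_mul_const, integral_id,
      hψint] at hψeq
    · have hc0 : c = 0 := by
        have h : (R ^ 2 - ε ^ 2) * c = 0 := by linarith
        exact (mul_eq_zero.1 h).resolve_left hd
      intro r hr
      have := hconst r hr
      linarith
    · refine ContinuousOn.intervalIntegrable fun r hr => ?_
      rw [Set.uIcc_of_le hεR.le] at hr
      exact (continuousAt_id.mul
        (hφ r (hε.trans_le hr.1).ne').continuousAt).continuousWithinAt
    · exact (continuous_id.mul continuous_const).intervalIntegrable _ _
end
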